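/- Let ‖·‖_X be a Haar system space norm. Then for all f, g ∈ H with |f(s)| ≤ |g(s)| for all s ∈ [0,1), one has ‖f‖_X ≤ ‖g‖_X. -/

import Mathlib

open MeasureTheory

noncomputable section

/-- A dyadic interval `[i/2^j, (i+1)/2^j) ⊆ [0,1)` (0-based position `i < 2^j`). -/
structure DyadicInt where
  j : ℕ
  i : ℕ
  hi : i < 2 ^ j

noncomputable instance : DecidableEq DyadicInt := Classical.decEq _

namespace DyadicInt

/-- The underlying set of the dyadic interval. -/
def set (I : DyadicInt) : Set ℝ :=
  Set.Ico ((I.i : ℝ) / 2 ^ I.j) (((I.i : ℝ) + 1) / 2 ^ I.j)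

/-- `|I|`, the length of the dyadic interval. -/
def len (I : DyadicInt) : ℝ := 1 / 2 ^ I.j

/-- The left half `I⁺` of `I`. -/
def left (I : DyadicInt) : DyadicInt :=
  ⟨I.j + 1, 2 * I.i, by have := I.hi; simp only [pow_succ]; omega⟩

/-- The right half `I⁻` of `I`. -/
def right (I : DyadicInt) : DyadicInt :=
  ⟨I.j + 1, 2 * I.i + 1, by have := I.hi; simp only [pow_succ]; omega⟩

/-- The root interval `[0,1)`. -/
def root : DyadicInt := ⟨0, 0, Nat.one_pos⟩

end DyadicInt

/-- The Haar function `h_I = χ_{I⁺} − χ_{I⁻}`. -/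
def haar (I : DyadicInt) : ℝ → ℝ :=
  fun s => I.left.set.indicator 1 s - I.right.set.indicator 1 s

/-- `χ_{[0,1)}`. -/
def unitChi : ℝ → ℝ := (Set.Ico (0 : ℝ) 1).indicator 1

/-- The Rademacher function `r_k = Σ_{I ∈ D_k} h_I`. -/
def rademacher (k : ℕ) : ℝ → ℝ :=
  fun s => ∑ i : Fin (2 ^ k), haar ⟨k, i.1, i.2⟩ s

/-- The collection `D_k` of dyadic intervals of length `2^{-k}`, as a finset. -/
def Dk (k : ℕ) : Finset DyadicInt :=
  (Finset.univ : Finset (Fin (2 ^ k))).image fun i => ⟨k, i.1, i.2⟩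

lemma Dk_nonempty (k : ℕ) : (Dk k).Nonempty :=
  ⟨⟨k, 0, Nat.two_pow_pos k⟩,
    Finset.mem_image.2 ⟨⟨0, Nat.two_pow_pos k⟩, Finset.mem_univ _, rfl⟩⟩

/-- The collection `D_{≤ n}`, as a finset. -/
def DleF (n : ℕ) : Finset DyadicInt := (Finset.range (n + 1)).biUnion Dk

/-- `H`: the linear span of the Haar functions together with `χ_{[0,1)}`. -/
def Hspace : Submodule ℝ (ℝ → ℝ) :=
  Submodule.span ℝ (Set.range haar ∪ {unitChi})

/-- `H₀`: the linear span of the Haar functions. -/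
def H0space : Submodule ℝ (ℝ → ℝ) := Submodule.span ℝ (Set.range haar)

/-- `|f|` and `|g|` have the same distribution w.r.t. Lebesgue measure on `[0,1)`. -/
def SameDist (f g : ℝ → ℝ) : Prop :=
  ∀ t : ℝ, volume {s ∈ Set.Ico (0 : ℝ) 1 | t < |f s|}
    = volume {s ∈ Set.Ico (0 : ℝ) 1 | t < |g s|}

/-- `⟨f, g⟩ = ∫₀¹ f(s) g(s) ds`. -/
def pairing (f g : ℝ → ℝ) : ℝ := ∫ s in Set.Ico (0 : ℝ) 1, f s * g s

/-- A Haar system space norm: a rearrangement-invariant norm on `H`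
with `‖χ_{[0,1)}‖ = 1`. -/
structure HaarSystemSpaceNorm where
  normX : (ℝ → ℝ) → ℝ
  nonneg : ∀ f ∈ Hspace, 0 ≤ normX f
  definite : ∀ f ∈ Hspace, normX f = 0 → f = 0
  smul : ∀ (c : ℝ), ∀ f ∈ Hspace, normX (c • f) = |c| * normX f
  triangle : ∀ f ∈ Hspace, ∀ g ∈ Hspace, normX (f + g) ≤ normX f + normX g
  rearrangement : ∀ f ∈ Hspace, ∀ g ∈ Hspace, SameDist f g → normX f = normX g
  chi_norm : normX unitChi = 1

/-- A Haar system Hardy space norm `‖·‖_Y` on `H₀`, built from a Haar system space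
norm `‖·‖_X` and a choice of Rademacher family `r` (either constant `r_0`, or the
independent family `r_{ι(I)}`). -/
structure HaarHardyNorm extends HaarSystemSpaceNorm where
  r : DyadicInt → ℝ → ℝ
  r_spec : (∀ I, r I = rademacher 0) ∨ (∀ I, r I = rademacher (2 ^ I.j + I.i))
  normY : (ℝ → ℝ) → ℝ
  normY_spec : ∀ a : DyadicInt → ℝ, (Function.support a).Finite →
    normY (fun s => ∑ᶠ I, a I * haar I s)
      = normX (fun s => ∫ u in Set.Ico (0 : ℝ) 1, |∑ᶠ I, r I u * (a I * haar I s)|)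

/-- `Y_n`: the linear span of `{h_I : I ∈ D_{≤ n}}`. -/
def Yspan (n : ℕ) : Submodule ℝ (ℝ → ℝ) :=
  Submodule.span ℝ (haar '' {I : DyadicInt | I.j ≤ n})

/-- `h_I` as an element of `Y_N`. -/
def haarY (N : ℕ) (I : DyadicInt) (h : I.j ≤ N) : Yspan N :=
  ⟨haar I, Submodule.subset_span ⟨I, h, rfl⟩⟩

/-- The operator norm (induced by `‖·‖_Y`) of a linear map `Y_n → Y_m`. -/
def opNorm (nm : HaarHardyNorm) {n m : ℕ} (T : Yspan n →ₗ[ℝ] Yspan m) : ℝ :=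
  sInf {C : ℝ | 0 ≤ C ∧ ∀ x : Yspan n, nm.normY (T x).1 ≤ C * nm.normY x.1}

/-- `S` factors through `T` with constant `C` (and error `0`). -/
def Factors (nm : HaarHardyNorm) {n N : ℕ} (S : Yspan n →ₗ[ℝ] Yspan n)
    (T : Yspan N →ₗ[ℝ] Yspan N) (C : ℝ) : Prop :=
  ∃ (B : Yspan n →ₗ[ℝ] Yspan N) (A : Yspan N →ₗ[ℝ] Yspan n),
    opNorm nm A * opNorm nm B ≤ C ∧ S = A ∘ₗ T ∘ₗ B

/-- `S` factors through `T` with constant `C` and error `η`. -/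
def FactorsErr (nm : HaarHardyNorm) {n N : ℕ} (S : Yspan n →ₗ[ℝ] Yspan n)
    (T : Yspan N →ₗ[ℝ] Yspan N) (C η : ℝ) : Prop :=
  ∃ (B : Yspan n →ₗ[ℝ] Yspan N) (A : Yspan N →ₗ[ℝ] Yspan n),
    opNorm nm A * opNorm nm B ≤ C ∧ opNorm nm (S - A ∘ₗ T ∘ₗ B) ≤ η

/-- `S` projectionally factors through `T` with constant `C` and error `η`. -/
def ProjFactorsErr (nm : HaarHardyNorm) {n N : ℕ} (S : Yspan n →ₗ[ℝ] Yspan n)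
    (T : Yspan N →ₗ[ℝ] Yspan N) (C η : ℝ) : Prop :=
  ∃ (B : Yspan n →ₗ[ℝ] Yspan N) (A : Yspan N →ₗ[ℝ] Yspan n),
    opNorm nm A * opNorm nm B ≤ C ∧ opNorm nm (S - A ∘ₗ T ∘ₗ B) ≤ η ∧
      A ∘ₗ B = LinearMap.id

/-- `T : Y_N → Y_N` has `δ`-large positive diagonal. -/
def LargePosDiag (δ : ℝ) {N : ℕ} (T : Yspan N →ₗ[ℝ] Yspan N) : Prop :=
  ∀ (I : DyadicInt) (h : I.j ≤ N), δ * I.len ≤ pairing (haar I) (T (haarY N I h)).1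

/-- `T : Y_N → Y_N` has `δ`-large diagonal. -/
def LargeDiag (δ : ℝ) {N : ℕ} (T : Yspan N →ₗ[ℝ] Yspan N) : Prop :=
  ∀ (I : DyadicInt) (h : I.j ≤ N), δ * I.len ≤ |pairing (haar I) (T (haarY N I h)).1|

/-- The Haar system is `K`-unconditional in `Y`. -/
def Unconditional (nm : HaarHardyNorm) (K : ℝ) : Prop :=
  ∀ a ε : DyadicInt → ℝ, (Function.support a).Finite → (∀ I, ε I = 1 ∨ ε I = -1) →
    nm.normY (fun s => ∑ᶠ I, ε I * a I * haar I s)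
      ≤ K * nm.normY (fun s => ∑ᶠ I, a I * haar I s)

/-- The dual norm `‖y‖_{Y*} = sup { ⟨y, x⟩ : x ∈ H₀, ‖x‖_Y ≤ 1 }`. -/
def dualNorm (nm : HaarHardyNorm) (y : ℝ → ℝ) : ℝ :=
  sSup {c : ℝ | ∃ x ∈ H0space, nm.normY x ≤ 1 ∧ c = pairing y x}

/-- `|B^*|`: the Lebesgue measure of the union of a finite collection of
dyadic intervals. -/
def starMeas (Bf : Finset DyadicInt) : ℝ := (volume (⋃ K ∈ Bf, K.set)).toReal

/-- The step function on `[0,1)` taking the value `c i` on `[i/2^N, (i+1)/2^N)`. -/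
def dyadicStep (N : ℕ) (c : ℕ → ℝ) : ℝ → ℝ :=
  (Set.Ico (0 : ℝ) 1).indicator fun s => c ⌊s * 2 ^ N⌋₊

lemma dyadicStep_of_mem {s : ℝ} (hs : s ∈ Set.Ico (0 : ℝ) 1) (N : ℕ) (c : ℕ → ℝ) :
    dyadicStep N c s = c ⌊s * 2 ^ N⌋₊ :=
  Set.indicator_of_mem hs _

lemma dyadicStep_of_notMem {s : ℝ} (hs : s ∉ Set.Ico (0 : ℝ) 1) (N : ℕ) (c : ℕ → ℝ) :
    dyadicStep N c s = 0 :=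
  Set.indicator_of_notMem hs _

lemma floor_mul_two_pow_lt {s : ℝ} (hs : s ∈ Set.Ico (0 : ℝ) 1) (N : ℕ) :
    ⌊s * 2 ^ N⌋₊ < 2 ^ N := by
  have h2 : (0 : ℝ) < 2 ^ N := by positivity
  rw [Nat.floor_lt (mul_nonneg hs.1 h2.le)]
  push_cast
  nlinarith [hs.2]

lemma floor_mul_two_pow_succ_div_two (s : ℝ) (N : ℕ) :
    ⌊s * 2 ^ (N + 1)⌋₊ / 2 = ⌊s * 2 ^ N⌋₊ := by
  rw [← Nat.floor_div_ofNat]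
  congr 1
  rw [pow_succ, ← mul_assoc, mul_div_cancel_right₀ _ two_ne_zero]

lemma dyadicStep_congr {N : ℕ} {c d : ℕ → ℝ} (h : ∀ i < 2 ^ N, c i = d i) :
    dyadicStep N c = dyadicStep N d := by
  funext s
  by_cases hs : s ∈ Set.Ico (0 : ℝ) 1
  · simp only [dyadicStep_of_mem hs]
    exact h _ (floor_mul_two_pow_lt hs N)
  · simp only [dyadicStep_of_notMem hs]

lemma dyadicStep_add (N : ℕ) (c d : ℕ → ℝ) :
    dyadicStep N (c + d) = dyadicStep N c + dyadicStep N d :=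
  Set.indicator_add _ _ _

lemma dyadicStep_sub (N : ℕ) (c d : ℕ → ℝ) :
    dyadicStep N (c - d) = dyadicStep N c - dyadicStep N d :=
  Set.indicator_sub _ _ _

lemma dyadicStep_smul (N : ℕ) (a : ℝ) (c : ℕ → ℝ) :
    dyadicStep N (a • c) = a • dyadicStep N c :=
  Set.indicator_const_smul _ a _

lemma dyadicStep_succ (N : ℕ) (c : ℕ → ℝ) :
    dyadicStep (N + 1) (fun i => c (i / 2)) = dyadicStep N c := by
  simp only [dyadicStep, floor_mul_two_pow_succ_div_two]

lemma exists_dyadicStep_eq_of_le {M N : ℕ} (h : M ≤ N) (c : ℕ → ℝ) :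
    ∃ d, dyadicStep M c = dyadicStep N d := by
  induction N, h using Nat.le_induction with
  | base => exact ⟨c, rfl⟩
  | succ N _ ih =>
    obtain ⟨d, hd⟩ := ih
    exact ⟨_, hd.trans (dyadicStep_succ N d).symm⟩

lemma indicator_dyadicInt (I : DyadicInt) :
    I.set.indicator 1 = dyadicStep I.j (Pi.single I.i 1) := by
  have h2 : (0 : ℝ) < 2 ^ I.j := by positivity
  have hi : (I.i : ℝ) + 1 ≤ 2 ^ I.j := by exact_mod_cast I.hi
  funext s
  by_cases hs : s ∈ Set.Ico (0 : ℝ) 1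
  · have key : s ∈ I.set ↔ ⌊s * 2 ^ I.j⌋₊ = I.i := by
      rw [Nat.floor_eq_iff (mul_nonneg hs.1 h2.le), DyadicInt.set, Set.mem_Ico,
        div_le_iff₀ h2, lt_div_iff₀ h2]
    rw [dyadicStep_of_mem hs]
    by_cases h : s ∈ I.set
    · simp [h, key.1 h]
    · simp [h, mt key.2 h]
  · rw [dyadicStep_of_notMem hs, Set.indicator_of_notMem]
    intro h
    rw [DyadicInt.set, Set.mem_Ico] at h
    exact hs ⟨le_trans (by positivity) h.1, h.2.trans_le ((div_le_one h2).2 hi)⟩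

lemma haar_eq_dyadicStep (I : DyadicInt) :
    haar I = dyadicStep (I.j + 1) (Pi.single (2 * I.i) 1 - Pi.single (2 * I.i + 1) 1) := by
  have h : haar I = I.left.set.indicator 1 - I.right.set.indicator 1 := rfl
  rw [h, indicator_dyadicInt, indicator_dyadicInt]
  exact (dyadicStep_sub _ _ _).symm

lemma unitChi_eq_dyadicStep : unitChi = dyadicStep 0 1 := rfl

lemma exists_dyadicStep_of_mem_Hspace {f : ℝ → ℝ} (hf : f ∈ Hspace) :
    ∃ N c, f = dyadicStep N c := by
  induction hf using Submodule.span_induction with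
  | mem f hf =>
    rcases hf with ⟨I, rfl⟩ | rfl
    · exact ⟨_, _, haar_eq_dyadicStep I⟩
    · exact ⟨_, _, unitChi_eq_dyadicStep⟩
  | zero => exact ⟨0, 0, (Set.indicator_zero ℝ _).symm⟩
  | add f g _ _ hf hg =>
    obtain ⟨M, c, rfl⟩ := hf
    obtain ⟨N, d, rfl⟩ := hg
    obtain ⟨c', hc⟩ := exists_dyadicStep_eq_of_le (le_max_left M N) c
    obtain ⟨d', hd⟩ := exists_dyadicStep_eq_of_le (le_max_right M N) d
    exact ⟨max M N, c' + d', by rw [dyadicStep_add, hc, hd]⟩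
  | smul a f _ hf =>
    obtain ⟨N, c, rfl⟩ := hf
    exact ⟨N, a • c, (dyadicStep_smul N a c).symm⟩

/-- One step of the Haar expansion: averages at level `N` plus Haar functions of level `N`. -/
lemma dyadicStep_succ_eq_add_sum_haar (N : ℕ) (c : ℕ → ℝ) :
    dyadicStep (N + 1) c = dyadicStep N (fun i => (c (2 * i) + c (2 * i + 1)) / 2) +
      ∑ i : Fin (2 ^ N), ((c (2 * i) - c (2 * i + 1)) / 2) • haar ⟨N, i, i.2⟩ := by
  funext s
  simp only [Pi.add_apply, Finset.sum_apply, Pi.smul_apply, smul_eq_mul, haar_eq_dyadicStep]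
  by_cases hs : s ∈ Set.Ico (0 : ℝ) 1
  · simp only [dyadicStep_of_mem hs, ← floor_mul_two_pow_succ_div_two s N]
    have hk := floor_mul_two_pow_lt hs (N + 1)
    generalize ⌊s * 2 ^ (N + 1)⌋₊ = k at hk
    have hq : k / 2 < 2 ^ N := by rw [pow_succ] at hk; omega
    rw [Finset.sum_eq_single (⟨k / 2, hq⟩ : Fin (2 ^ N))]
    · rcases Nat.even_or_odd' k with ⟨q, rfl | rfl⟩
      · have h : 2 * q / 2 = q := by omega
        simp only [h, Pi.sub_apply, Pi.single_apply]
        simp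
        ring
      · have h : (2 * q + 1) / 2 = q := by omega
        simp only [h, Pi.sub_apply, Pi.single_apply]
        simp
        ring
    · intro i _ hi
      have hi' : (i : ℕ) ≠ k / 2 := fun h => hi (Fin.ext h)
      have h1 : k ≠ 2 * i := by omega
      have h2 : k ≠ 2 * i + 1 := by omega
      simp [h1, h2]
    · simp
  · simp [dyadicStep_of_notMem hs]

lemma dyadicStep_mem_Hspace (N : ℕ) (c : ℕ → ℝ) : dyadicStep N c ∈ Hspace := by
  induction N generalizing c with
  | zero =>
    have h : dyadicStep 0 c = c 0 • unitChi := by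
      rw [unitChi_eq_dyadicStep, ← dyadicStep_smul]
      refine dyadicStep_congr fun i hi => ?_
      obtain rfl : i = 0 := by simpa using hi
      simp
    rw [h]
    exact Hspace.smul_mem _ (Submodule.subset_span (Or.inr rfl))
  | succ N ih =>
    rw [dyadicStep_succ_eq_add_sum_haar]
    exact Hspace.add_mem (ih _) (Hspace.sum_mem fun i _ =>
      Hspace.smul_mem _ (Submodule.subset_span (Or.inl ⟨_, rfl⟩)))

lemma sameDist_of_abs_eq {f g : ℝ → ℝ} (h : ∀ s, |f s| = |g s|) : SameDist f g := by
  intro t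
  simp only [h]

namespace HaarSystemSpaceNorm

variable (X : HaarSystemSpaceNorm)

/-- Shrinking one coefficient is a convex combination of the identity and a sign flip. -/
lemma normX_dyadicStep_update_le (N : ℕ) (e : ℕ → ℝ) (n : ℕ) {x : ℝ} (hx : |x| ≤ |e n|) :
    X.normX (dyadicStep N (Function.update e n x)) ≤ X.normX (dyadicStep N e) := by
  obtain ⟨t, ht, rfl⟩ : ∃ t : ℝ, |t| ≤ 1 ∧ x = t * e n := by
    refine ⟨x / e n, ?_, ?_⟩
    · rw [abs_div]
      exact div_le_one_of_le₀ hx (abs_nonneg _)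
    · by_cases h : e n = 0
      · rw [h, abs_zero] at hx
        simpa [h] using hx
      · field_simp
  set e' := Function.update e n (-e n) with he'
  have hflip : X.normX (dyadicStep N e') = X.normX (dyadicStep N e) := by
    refine X.rearrangement _ (dyadicStep_mem_Hspace _ _) _ (dyadicStep_mem_Hspace _ _)
      (sameDist_of_abs_eq fun s => ?_)
    by_cases hs : s ∈ Set.Ico (0 : ℝ) 1
    · simp only [dyadicStep_of_mem hs, he', Function.update_apply]
      split_ifs with h
      · rw [h, abs_neg]
      · rfl
    · simp only [dyadicStep_of_notMem hs]
  have hconv : Function.update e n (t * e n) = ((1 + t) / 2) • e + ((1 - t) / 2) • e' := by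
    funext i
    simp only [he', Pi.add_apply, Pi.smul_apply, smul_eq_mul, Function.update_apply]
    split_ifs with h
    · rw [h]
      ring
    · ring
  obtain ⟨h1, h2⟩ := abs_le.1 ht
  have hmem := dyadicStep_mem_Hspace N
  rw [hconv, dyadicStep_add, dyadicStep_smul, dyadicStep_smul]
  calc _ ≤ _ := X.triangle _ (Hspace.smul_mem _ (hmem e)) _ (Hspace.smul_mem _ (hmem e'))
    _ = X.normX (dyadicStep N e) := by
      rw [X.smul _ _ (hmem e), X.smul _ _ (hmem e'), hflip, abs_of_nonneg (by linarith),
        abs_of_nonneg (by linarith)]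
      ring

lemma normX_dyadicStep_mono (N : ℕ) {c d : ℕ → ℝ} (h : ∀ i < 2 ^ N, |c i| ≤ |d i|) :
    X.normX (dyadicStep N c) ≤ X.normX (dyadicStep N d) := by
  have key : ∀ n ≤ 2 ^ N, X.normX (dyadicStep N fun i => if i < n then c i else d i) ≤
      X.normX (dyadicStep N d) := by
    intro n
    induction n with
    | zero => simp
    | succ n ih =>
      intro hn
      refine le_trans ?_ (ih (by omega))
      have hu : (fun i => if i < n + 1 then c i else d i) =
          Function.update (fun i => if i < n then c i else d i) n (c n) := by
        funext i
        rw [Function.update_apply]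
        grind
      rw [hu]
      exact X.normX_dyadicStep_update_le N _ n (by simpa using h n hn)
  rw [dyadicStep_congr (d := fun i => if i < 2 ^ N then c i else d i) fun i hi => by simp [hi]]
  exact key _ le_rfl

end HaarSystemSpaceNorm

/-- pointwise domination implies norm domination. -/
theorem statement14 (X : HaarSystemSpaceNorm) (f g : ℝ → ℝ)
    (hf : f ∈ Hspace) (hg : g ∈ Hspace)
    (hfg : ∀ s ∈ Set.Ico (0 : ℝ) 1, |f s| ≤ |g s|) :
    X.normX f ≤ X.normX g := by
  obtain ⟨M, c, rfl⟩ := exists_dyadicStep_of_mem_Hspace hf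
  obtain ⟨N, d, rfl⟩ := exists_dyadicStep_of_mem_Hspace hg
  obtain ⟨c', hc⟩ := exists_dyadicStep_eq_of_le (le_max_left M N) c
  obtain ⟨d', hd⟩ := exists_dyadicStep_eq_of_le (le_max_right M N) d
  rw [hc, hd] at hfg ⊢
  refine X.normX_dyadicStep_mono _ fun i hi => ?_
  generalize max M N = K at hfg hi
  have h2 : (0 : ℝ) < 2 ^ K := by positivity
  have hs : (i : ℝ) / 2 ^ K ∈ Set.Ico (0 : ℝ) 1 :=
    ⟨by positivity, (div_lt_one h2).2 (by exact_mod_cast hi)⟩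
  simpa [dyadicStep_of_mem hs, div_mul_cancel₀ _ h2.ne'] using hfg _ hs
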